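/- Let k be a commutative ring, d ≥ 1, and M, N finitely generated projective k-modules, regarded as submodules of M ⊕ N. Then for each 0 ≤ c ≤ d, the shuffle multiplication map Γ^c M ⊗ Γ^{d-c} N → Γ^d(M ⊕ N), x ⊗ y ↦ x * y, is injective, and Γ^d(M ⊕ N) is the direct sum of the images: Γ^d(M ⊕ N) = ⊕_{c=0}^{d} Γ^c(M) * Γ^{d-c}(N). -/

import Mathlib

open scoped TensorProduct
open PiTensorProduct

variable (k : Type*) [CommRing k]

/-- Right action of a permutation `σ ∈ S_d` on the `d`-th tensor power. -/
noncomputable def permAction (M : Type*) [AddCommGroup M] [Module k M] {d : ℕ}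
    (σ : Equiv.Perm (Fin d)) : (⨂[k]^d M) →ₗ[k] (⨂[k]^d M) :=
  (PiTensorProduct.reindex k (fun _ : Fin d => M) σ).toLinearMap

/-- The `d`-th divided power `Γ^d M = (M^{⊗d})^{S_d}`, the submodule of symmetric tensors. -/
noncomputable def dividedPower (M : Type*) [AddCommGroup M] [Module k M] (d : ℕ) :
    Submodule k (⨂[k]^d M) where
  carrier := {x | ∀ σ : Equiv.Perm (Fin d), permAction k M σ x = x}
  add_mem' := fun ha hb σ => by rw [map_add, ha σ, hb σ]
  zero_mem' := fun σ => map_zero _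
  smul_mem' := fun c x hx σ => by rw [map_smul, hx σ]

lemma map_mem_dividedPower {M N : Type*} [AddCommGroup M] [Module k M]
    [AddCommGroup N] [Module k N] {d : ℕ} (f : M →ₗ[k] N) {x : ⨂[k]^d M}
    (hx : x ∈ dividedPower k M d) :
    PiTensorProduct.map (fun _ : Fin d => f) x ∈ dividedPower k N d := by
  intro σ
  have hxσ : (PiTensorProduct.reindex k (fun _ : Fin d => M) σ) x = x := hx σ
  have h := PiTensorProduct.map_reindex (fun _ : Fin d => f) (σ : Fin d ≃ Fin d) x
  show (PiTensorProduct.reindex k (fun _ : Fin d => N) σ)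
      ((PiTensorProduct.map fun _ => f) x) = (PiTensorProduct.map fun _ => f) x
  rw [← h, hxσ]

/-- The functorial action `Γ^d f : Γ^d M → Γ^d N` of a linear map. -/
noncomputable def dividedPowerMap {M N : Type*} [AddCommGroup M] [Module k M]
    [AddCommGroup N] [Module k N] (d : ℕ) (f : M →ₗ[k] N) :
    (dividedPower k M d) →ₗ[k] (dividedPower k N d) :=
  (PiTensorProduct.map (fun _ : Fin d => f)).restrict
    (fun _ hx => map_mem_dividedPower k f hx)

/-- The canonical interchange map `M^{⊗d} ⊗ N^{⊗d} → (M ⊗ N)^{⊗d}`. -/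
noncomputable def interchange (M N : Type*) [AddCommGroup M] [Module k M]
    [AddCommGroup N] [Module k N] (d : ℕ) :
    (⨂[k]^d M) ⊗[k] (⨂[k]^d N) →ₗ[k] ⨂[k]^d (M ⊗[k] N) :=
  TensorProduct.lift (PiTensorProduct.map₂ (fun _ : Fin d => TensorProduct.mk k M N))
/-- Concatenation `M^{⊗d} ⊗ M^{⊗e} ≅ M^{⊗(d+e)}`. -/
noncomputable def concatMap (M : Type*) [AddCommGroup M] [Module k M] (d e : ℕ) :
    (⨂[k]^d M) ⊗[k] (⨂[k]^e M) →ₗ[k] ⨂[k]^(d + e) M :=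
  ((PiTensorProduct.reindex k (fun _ : Fin d ⊕ Fin e => M) finSumFinEquiv).toLinearMap).comp
    (PiTensorProduct.tmulEquiv k M (ι := Fin d) (ι₂ := Fin e)).toLinearMap

/-- The permutation associated to a `d`-element subset `S` of `Fin (d+e)`: it sends the
first `d` positions increasingly onto `S` and the remaining positions increasingly onto
the complement of `S`.  These are the minimal-length coset representatives of
`S_d × S_e` in `S_{d+e}`. -/
noncomputable def finUnshuffle (d e : ℕ) (S : Finset (Fin (d + e))) (hS : S.card = d) :
    Equiv.Perm (Fin (d + e)) :=
  finSumFinEquiv.symm.trans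
    ((Equiv.sumCongr (S.orderIsoOfFin hS).toEquiv
        (Sᶜ.orderIsoOfFin (by rw [Finset.card_compl, hS, Fintype.card_fin]; omega)).toEquiv).trans
      ((Equiv.sumCongr (Equiv.refl _)
          (Equiv.subtypeEquivRight (fun x => Finset.mem_compl))).trans
        (Equiv.sumCompl (· ∈ S))))

/-- The shuffle multiplication `∇ : Γ^d M ⊗ Γ^e M → Γ^{d+e} M`, `x ⊗ y ↦ x * y`,
defined on the ambient tensor powers:  `x * y = Σ_σ (x ⊗ y)σ`, the sum over the
minimal-length representatives of the cosets of `S_d × S_e` in `S_{d+e}`. -/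
noncomputable def shuffleMul (M : Type*) [AddCommGroup M] [Module k M] (d e : ℕ) :
    (⨂[k]^d M) ⊗[k] (⨂[k]^e M) →ₗ[k] ⨂[k]^(d + e) M :=
  ∑ S ∈ ({S : Finset (Fin (d + e)) | S.card = d} : Finset _).attach,
    (permAction k M (finUnshuffle d e S.1 (by simpa using S.2))).comp (concatMap k M d e)

/-- Cast between tensor powers of equal exponents. -/
noncomputable def castPow (M : Type*) [AddCommGroup M] [Module k M] {m n : ℕ} (h : m = n) :
    (⨂[k]^m M) ≃ₗ[k] ⨂[k]^n M :=
  PiTensorProduct.reindex k (fun _ : Fin m => M) (finCongr h)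

/-- The map `Γ^c M ⊗ Γ^{d-c} N → Γ^d (M ⊕ N)`, `x ⊗ y ↦ x * y` (shuffle product inside
`Γ(M ⊕ N)`, with `M`, `N` regarded as submodules of `M ⊕ N`), valued in the ambient
tensor power. -/
noncomputable def shufflePiece {k : Type*} [CommRing k] (M N : Type*)
    [AddCommGroup M] [Module k M] [AddCommGroup N] [Module k N]
    (d c : ℕ) (hc : c ≤ d) :
    (↥(dividedPower k M c) ⊗[k] ↥(dividedPower k N (d - c))) →ₗ[k] ⨂[k]^d (M × N) :=
  (castPow k (M × N) (by omega : c + (d - c) = d)).toLinearMap ∘ₗ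
    (shuffleMul k (M × N) c (d - c)) ∘ₗ
    TensorProduct.map
      ((dividedPower k (M × N) c).subtype ∘ₗ dividedPowerMap k c (LinearMap.inl k M N))
      ((dividedPower k (M × N) (d - c)).subtype ∘ₗ
        dividedPowerMap k (d - c) (LinearMap.inr k M N))

section Helpers

/-- Non-dependent reindexing. -/
noncomputable def rx (V : Type*) [AddCommGroup V] [Module k V] {ι κ : Type*} (e : ι ≃ κ) :
    (⨂[k] _ : ι, V) →ₗ[k] (⨂[k] _ : κ, V) :=
  (PiTensorProduct.reindex k (fun _ : ι => V) e).toLinearMap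

section
variable {k}
variable {V W : Type*} [AddCommGroup V] [Module k V] [AddCommGroup W] [Module k W]
variable {ι κ μ : Type*}

lemma rx_tprod (e : ι ≃ κ) (f : ι → V) :
    rx k V e (tprod k f) = tprod k (fun i => f (e.symm i)) :=
  PiTensorProduct.reindex_tprod e f

lemma rx_rx (e : ι ≃ κ) (e' : κ ≃ μ) (x : ⨂[k] _ : ι, V) :
    rx k V e' (rx k V e x) = rx k V (e.trans e') x := by
  have : rx k V e' ∘ₗ rx k V e = rx k V (e.trans e') := by
    apply PiTensorProduct.ext
    ext f
    simp [rx_tprod]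
  exact LinearMap.congr_fun this x

lemma rx_refl (x : ⨂[k] _ : ι, V) : rx k V (Equiv.refl ι) x = x := by
  have : rx k V (Equiv.refl ι) = LinearMap.id := by
    apply PiTensorProduct.ext
    ext f
    simp [rx_tprod]
  exact LinearMap.congr_fun this x

lemma map_rx (f : ι → V →ₗ[k] W) (e : ι ≃ κ) (x : ⨂[k] _ : ι, V) :
    PiTensorProduct.map (fun i => f (e.symm i)) (rx k V e x) =
      rx k W e (PiTensorProduct.map f x) := by
  have : PiTensorProduct.map (fun i => f (e.symm i)) ∘ₗ (rx k V e) =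
      rx k W e ∘ₗ (PiTensorProduct.map f) := by
    apply PiTensorProduct.ext
    ext f
    simp [rx_tprod]
  exact LinearMap.congr_fun this x

lemma mem_dp {d : ℕ} {x : ⨂[k]^d V} :
    x ∈ dividedPower k V d ↔ ∀ σ : Equiv.Perm (Fin d), rx k V σ x = x := Iff.rfl

/-- A good projector onto the symmetric tensors. -/
def GoodProj (V : Type*) [AddCommGroup V] [Module k V] (d : ℕ)
    (R : (⨂[k]^d V) →ₗ[k] (⨂[k]^d V)) : Prop :=
  (∀ x, R x ∈ dividedPower k V d) ∧
  ∃ (n : ℕ) (T : Fin n → ((⨂[k]^d V) →ₗ[k] (⨂[k]^d V))) (σ : Fin n → Equiv.Perm (Fin d)),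
    R = LinearMap.id + ∑ i, T i ∘ₗ (rx k V (σ i) - LinearMap.id)

lemma exists_rep (n d : ℕ) : ∃ (rep : (Fin d → Fin n) → (Fin d → Fin n))
    (s : (Fin d → Fin n) → Equiv.Perm (Fin d)),
    (∀ f, rep f = fun i => f ((s f).symm i)) ∧
    ∀ f (τ : Equiv.Perm (Fin d)), rep (fun i => f (τ i)) = rep f := by
  let r : Setoid (Fin d → Fin n) :=
    { r := fun f g => ∃ τ : Equiv.Perm (Fin d), g = fun i => f (τ i)
      iseqv := ⟨fun f => ⟨1, rfl⟩, fun {f g} ⟨τ, h⟩ => ⟨τ.symm, by simp [h]⟩,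
        fun {f g l} ⟨τ, h⟩ ⟨τ', h'⟩ => ⟨τ'.trans τ, by simp [h, h']⟩⟩ }
  have h : ∀ f, ∃ s : Equiv.Perm (Fin d), (Quotient.mk r f).out = fun i => f (s.symm i) := by
    intro f
    obtain ⟨τ, h⟩ := Setoid.symm (Quotient.mk_out (s := r) f)
    exact ⟨τ.symm, h⟩
  choose s hs using h
  refine ⟨fun f => (Quotient.mk r f).out, s, hs, fun f τ => ?_⟩
  have : Quotient.mk r (fun i => f (τ i)) = Quotient.mk r f :=
    Quotient.sound (Setoid.symm ⟨τ, rfl⟩)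
  simp only [this]

lemma goodProj_free (n d : ℕ) : ∃ R, GoodProj (k := k) (Fin n → k) d R := by
  classical
  obtain ⟨rep, s, hs, hrep⟩ := exists_rep n d
  let b : Module.Basis (Fin d → Fin n) k (⨂[k]^d (Fin n → k)) :=
    Basis.piTensorProduct (fun _ : Fin d => Pi.basisFun k (Fin n))
  have hb : ∀ (f) (σ : Equiv.Perm (Fin d)), rx k _ σ (b f) = b (fun i => f (σ.symm i)) := by
    intro f σ
    simp only [b, Basis.piTensorProduct_apply]
    exact rx_tprod _ _
  have hco : ∀ f (σ : Equiv.Perm (Fin d)) x,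
      b.coord (fun i => f (σ.symm i)) (rx k _ σ x) = b.coord f x := by
    intro f σ x
    have : b.coord (fun i => f (σ.symm i)) ∘ₗ (rx k _ σ) = b.coord f := by
      apply b.ext
      intro g
      rw [LinearMap.comp_apply, hb]
      simp only [Module.Basis.coord_apply, Module.Basis.repr_self, Finsupp.single_apply]
      congr 1
      simp only [funext_iff, eq_iff_iff]
      exact ⟨fun h i => by simpa using h (σ i), fun h i => h _⟩
    exact LinearMap.congr_fun this x
  let R : (⨂[k]^d (Fin n → k)) →ₗ[k] (⨂[k]^d (Fin n → k)) :=
    ∑ f, (b.coord (rep f)).smulRight (b f)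
  have hR : ∀ x, R x = ∑ f, b.coord (rep f) x • b f := by
    intro x; simp [R, LinearMap.sum_apply]
  refine ⟨R, ?_, ?_⟩
  · intro x
    rw [mem_dp]
    intro σ
    rw [hR, map_sum]
    refine Fintype.sum_equiv (Equiv.arrowCongr σ (Equiv.refl _)) _ _ ?_
    intro f
    rw [map_smul, hb]
    have := hrep f σ.symm
    simp only [Equiv.arrowCongr, Equiv.coe_fn_mk]
    rw [← this]
    rfl
  · let eqv := Fintype.equivFin (Fin d → Fin n)
    refine ⟨_, fun j => -(b.coord (rep (eqv.symm j))).smulRight (b (eqv.symm j)),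
      fun j => s (eqv.symm j), ?_⟩
    rw [Equiv.sum_comp eqv.symm (fun f => (-(b.coord (rep f)).smulRight (b f)) ∘ₗ
      (rx k _ (s f) - LinearMap.id))]
    apply LinearMap.ext
    intro x
    rw [hR]
    simp only [LinearMap.add_apply, LinearMap.id_apply, LinearMap.sum_apply, LinearMap.comp_apply,
      LinearMap.sub_apply, LinearMap.neg_apply, LinearMap.smulRight_apply, map_sub]
    have h1 : x = ∑ f, b.coord f x • b f := by
      simp [b.sum_repr x]
    have h2 : ∀ f, b.coord (rep f) (rx k _ (s f) x) = b.coord f x := by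
      intro f; rw [hs f]; exact hco f (s f) x
    simp only [h2, Finset.sum_neg_distrib, Finset.sum_sub_distrib, ← h1]
    abel

lemma goodProj_exists (V : Type*) [AddCommGroup V] [Module k V] [Module.Finite k V]
    [Module.Projective k V] (d : ℕ) : ∃ R, GoodProj (k := k) V d R := by
  obtain ⟨n, p, j, -, -, hpj⟩ := Module.Finite.exists_comp_eq_id_of_projective k V
  obtain ⟨R, hR, m, T, σ, hT⟩ := goodProj_free (k := k) n d
  have hrx : ∀ (τ : Equiv.Perm (Fin d)) x,
      rx k _ τ (PiTensorProduct.map (fun _ : Fin d => j) x) =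
        PiTensorProduct.map (fun _ : Fin d => j) (rx k V τ x) := fun τ x =>
    (map_rx (fun _ => j) τ x).symm
  have hpj' : ∀ x, PiTensorProduct.map (fun _ : Fin d => p)
      (PiTensorProduct.map (fun _ : Fin d => j) x) = x := by
    intro x
    rw [← LinearMap.comp_apply, ← PiTensorProduct.map_comp]
    simp [hpj]
  refine ⟨PiTensorProduct.map (fun _ => p) ∘ₗ R ∘ₗ PiTensorProduct.map (fun _ => j), ?_, m,
    fun i => PiTensorProduct.map (fun _ => p) ∘ₗ T i ∘ₗ PiTensorProduct.map (fun _ => j), σ, ?_⟩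
  · intro x
    exact map_mem_dividedPower k p (hR _)
  · apply LinearMap.ext
    intro x
    simp only [hT, LinearMap.add_apply, LinearMap.id_apply, LinearMap.sum_apply,
      LinearMap.comp_apply, LinearMap.sub_apply, map_add, map_sum, map_sub, hpj', hrx]

lemma GoodProj.fix {d : ℕ} {R : (⨂[k]^d V) →ₗ[k] (⨂[k]^d V)} (hR : GoodProj V d R)
    (x : ⨂[k]^d V) (hx : x ∈ dividedPower k V d) : R x = x := by
  obtain ⟨-, n, T, σ, rfl⟩ := hR
  rw [mem_dp] at hx
  simp [LinearMap.sum_apply, hx]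

lemma GoodProj.fix_rTensor {d : ℕ} {R : (⨂[k]^d V) →ₗ[k] (⨂[k]^d V)} (hR : GoodProj V d R)
    (x : (⨂[k]^d V) ⊗[k] W) (hx : ∀ σ : Equiv.Perm (Fin d), (rx k V σ).rTensor W x = x) :
    R.rTensor W x = x := by
  obtain ⟨-, n, T, σ, rfl⟩ := hR
  rw [← LinearMap.coe_rTensorHom, map_add, map_sum]
  simp only [LinearMap.coe_rTensorHom, LinearMap.add_apply, LinearMap.rTensor_id_apply,
    LinearMap.sum_apply, LinearMap.rTensor_comp_apply, LinearMap.rTensor_sub,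
    LinearMap.sub_apply, hx]
  simp

lemma GoodProj.fix_lTensor {d : ℕ} {R : (⨂[k]^d V) →ₗ[k] (⨂[k]^d V)} (hR : GoodProj V d R)
    (x : W ⊗[k] (⨂[k]^d V)) (hx : ∀ σ : Equiv.Perm (Fin d), (rx k V σ).lTensor W x = x) :
    R.lTensor W x = x := by
  obtain ⟨-, n, T, σ, rfl⟩ := hR
  rw [← LinearMap.coe_lTensorHom, map_add, map_sum]
  simp only [LinearMap.coe_lTensorHom, LinearMap.add_apply, LinearMap.lTensor_id_apply,
    LinearMap.sum_apply, LinearMap.lTensor_comp_apply, LinearMap.lTensor_sub,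
    LinearMap.sub_apply, hx]
  simp

lemma tt_ext {α β : Type*} {E : Type*} [AddCommGroup E] [Module k E]
    {f g : (⨂[k] _ : α, V) ⊗[k] (⨂[k] _ : β, W) →ₗ[k] E}
    (h : ∀ a b, f (tprod k a ⊗ₜ tprod k b) = g (tprod k a ⊗ₜ tprod k b)) : f = g := by
  apply TensorProduct.ext
  apply PiTensorProduct.ext
  ext a : 1
  apply PiTensorProduct.ext
  ext b : 1
  exact h a b

variable (k) in
/-- The inclusion of the mixed tensors. -/
noncomputable def gg (M N : Type*) [AddCommGroup M] [Module k M] [AddCommGroup N] [Module k N]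
    (α β : Type*) :
    (⨂[k] _ : α, M) ⊗[k] (⨂[k] _ : β, N) →ₗ[k] (⨂[k] _ : α ⊕ β, M × N) :=
  (PiTensorProduct.tmulEquiv k (M × N) (ι := α) (ι₂ := β)).toLinearMap ∘ₗ
    TensorProduct.map (PiTensorProduct.map (fun _ => LinearMap.inl k M N))
      (PiTensorProduct.map (fun _ => LinearMap.inr k M N))

variable (k) in
/-- The projection to the mixed tensors. -/
noncomputable def hh (M N : Type*) [AddCommGroup M] [Module k M] [AddCommGroup N] [Module k N]
    (α β : Type*) :
    (⨂[k] _ : α ⊕ β, M × N) →ₗ[k] (⨂[k] _ : α, M) ⊗[k] (⨂[k] _ : β, N) :=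
  TensorProduct.map (PiTensorProduct.map (fun _ => LinearMap.fst k M N))
      (PiTensorProduct.map (fun _ => LinearMap.snd k M N)) ∘ₗ
  (PiTensorProduct.tmulEquiv k (M × N) (ι := α) (ι₂ := β)).symm.toLinearMap

variable {α β : Type*}

lemma gg_tprod (a : α → V) (b : β → W) :
    gg k V W α β (tprod k a ⊗ₜ tprod k b) =
      tprod k (Sum.elim (fun i => (a i, (0 : W))) (fun i => ((0 : V), b i))) := by
  simp [gg]

lemma hh_tprod (a : α ⊕ β → V × W) :
    hh k V W α β (tprod k a) =
      (tprod k fun i => (a (Sum.inl i)).1) ⊗ₜ (tprod k fun i => (a (Sum.inr i)).2) := by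
  simp [hh]

lemma hh_gg (x) : hh k V W α β (gg k V W α β x) = x := by
  have : hh k V W α β ∘ₗ gg k V W α β = LinearMap.id := by
    apply tt_ext
    intro a b
    simp [gg_tprod, hh_tprod]
  exact LinearMap.congr_fun this x

variable (k V W) in
/-- Projector to the first summand. -/
noncomputable def pP : V × W →ₗ[k] V × W := LinearMap.inl k V W ∘ₗ LinearMap.fst k V W

variable (k V W) in
/-- Projector to the second summand. -/
noncomputable def pQ : V × W →ₗ[k] V × W := LinearMap.inr k V W ∘ₗ LinearMap.snd k V W

lemma gg_hh (x) : gg k V W α β (hh k V W α β x) =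
    PiTensorProduct.map (Sum.elim (fun _ => pP k V W) (fun _ => pQ k V W)) x := by
  have : gg k V W α β ∘ₗ hh k V W α β =
      PiTensorProduct.map (Sum.elim (fun _ => pP k V W) (fun _ => pQ k V W)) := by
    apply PiTensorProduct.ext
    ext a
    simp only [LinearMap.compMultilinearMap_apply, LinearMap.comp_apply, hh_tprod, gg_tprod,
      PiTensorProduct.map_tprod]
    congr 1
    ext (i | i) <;> simp [pP, pQ]
  exact LinearMap.congr_fun this x

lemma rx_gg {α' β' : Type*} (e₁ : α ≃ α') (e₂ : β ≃ β') (x) :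
    rx k (V × W) (Equiv.sumCongr e₁ e₂) (gg k V W α β x) =
      gg k V W α' β' (TensorProduct.map (rx k V e₁) (rx k W e₂) x) := by
  have : rx k (V × W) (Equiv.sumCongr e₁ e₂) ∘ₗ gg k V W α β  =
      gg k V W α' β' ∘ₗ (TensorProduct.map (rx k V e₁) (rx k W e₂)) := by
    apply tt_ext
    intro a b
    simp only [LinearMap.comp_apply, TensorProduct.map_tmul, gg_tprod, rx_tprod]
    congr 1
    ext (i | i) <;> simp
  exact LinearMap.congr_fun this x

lemma hh_rx {α' β' : Type*} (e₁ : α ≃ α') (e₂ : β ≃ β') (x) :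
    hh k V W α' β' (rx k (V × W) (Equiv.sumCongr e₁ e₂) x) =
      TensorProduct.map (rx k V e₁) (rx k W e₂) (hh k V W α β x) := by
  have : hh k V W α' β' ∘ₗ rx k (V × W) (Equiv.sumCongr e₁ e₂) =
      TensorProduct.map (rx k V e₁) (rx k W e₂) ∘ₗ hh k V W α β := by
    apply PiTensorProduct.ext
    ext a
    simp only [LinearMap.compMultilinearMap_apply, LinearMap.comp_apply, hh_tprod, rx_tprod,
      TensorProduct.map_tmul]
    rfl
  exact LinearMap.congr_fun this x

variable (k V W) in
/-- The projector attached to a subset of positions. -/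
noncomputable def piS [DecidableEq ι] (S : Finset ι) :
    (⨂[k] _ : ι, V × W) →ₗ[k] (⨂[k] _ : ι, V × W) :=
  PiTensorProduct.map (S.piecewise (fun _ => pP k V W) (fun _ => pQ k V W))

lemma piS_sum [DecidableEq ι] [Fintype ι] (x) : ∑ S : Finset ι, piS k V W S x = x := by
  have h := (PiTensorProduct.mapMultilinear k (fun _ : ι => V × W) (fun _ => V × W)).map_add_univ
    (fun _ => pP k V W) (fun _ => pQ k V W)
  have h2 : (fun _ : ι => pP k V W) + (fun _ => pQ k V W) = fun _ => LinearMap.id := by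
    funext i
    apply LinearMap.ext
    intro v
    simp [pP, pQ]
  rw [h2] at h
  have h3 := LinearMap.congr_fun h x
  simp only [PiTensorProduct.mapMultilinear_apply, PiTensorProduct.map_id, LinearMap.id_apply,
    LinearMap.sum_apply] at h3
  exact h3.symm

lemma piS_ne [DecidableEq ι] {S T : Finset ι} (hST : S ≠ T) (x) :
    piS k V W S (piS k V W T x) = 0 := by
  unfold piS
  rw [← LinearMap.comp_apply, ← PiTensorProduct.map_comp]
  obtain ⟨i, hi⟩ : ∃ i, ¬ (i ∈ S ↔ i ∈ T) := by
    by_contra! h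
    exact hST (Finset.ext h)
  rw [← PiTensorProduct.mapMultilinear_apply, MultilinearMap.map_coord_zero _ i]
  · rfl
  · by_cases h1 : i ∈ S <;> by_cases h2 : i ∈ T
    · exact absurd (by simp [h1, h2]) hi
    · ext <;> simp [h1, h2, pP, pQ]
    · ext <;> simp [h1, h2, pP, pQ]
    · exact absurd (by simp [h1, h2]) hi

lemma piS_rx [DecidableEq ι] (τ : α ⊕ β ≃ ι) (S : Finset ι)
    (hS : ∀ x, τ x ∈ S ↔ x.isLeft) (x) :
    piS k V W S (rx k (V × W) τ x) = rx k (V × W) τ (gg k V W α β (hh k V W α β x)) := by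
  rw [gg_hh, ← map_rx]
  unfold piS
  congr 2
  funext i
  obtain ⟨j, rfl⟩ := τ.surjective i
  have := hS j
  rcases j with j | j
  · have h : τ (Sum.inl j) ∈ S := this.2 rfl
    simp [h]
  · have h : τ (Sum.inr j) ∉ S := by simpa using this
    simp [h]

lemma exists_sumCongr [Finite α] [Finite β] (h : Equiv.Perm (α ⊕ β))
    (hl : ∀ x, (h x).isLeft = x.isLeft) :
    ∃ (h₁ : Equiv.Perm α) (h₂ : Equiv.Perm β), h = Equiv.sumCongr h₁ h₂ := by
  have : Set.MapsTo h (Set.range Sum.inl) (Set.range Sum.inl) := by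
    rintro _ ⟨a, rfl⟩
    have := hl (Sum.inl a)
    obtain ⟨y, hy⟩ := Sum.isLeft_iff.1 this
    exact ⟨y, hy.symm⟩
  obtain ⟨⟨h₁, h₂⟩, hh⟩ := Equiv.Perm.mem_sumCongrHom_range_of_perm_mapsTo_inl this
  exact ⟨h₁, h₂, hh.symm⟩

lemma exists_tau (U : Type*) [AddCommGroup U] [Module k U] (c e d : ℕ) (h : c + e = d) :
    ∃ τ : Finset (Fin d) → (Fin c ⊕ Fin e ≃ Fin d),
      (∀ S, S.card = c → ∀ x, τ S x ∈ S ↔ x.isLeft) ∧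
      ∀ u, castPow k U h (shuffleMul k U c e u) =
        ∑ S ∈ Finset.powersetCard c Finset.univ,
          rx k U (τ S) (PiTensorProduct.tmulEquiv k U (ι := Fin c) (ι₂ := Fin e) u) := by
  classical
  subst h
  refine ⟨fun S => if hS : S.card = c then finSumFinEquiv.trans (finUnshuffle c e S hS)
    else finSumFinEquiv, ?_, ?_⟩
  · intro S hS x
    simp only [hS, dite_true, finUnshuffle]
    rcases x with x | x
    · simp
    · simp only [Equiv.trans_apply, Equiv.symm_apply_apply, Equiv.sumCongr_apply, Sum.map_inr,
        Equiv.sumCompl_apply_inr, Sum.isLeft_inr]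
      simp only [Bool.false_eq_true, iff_false]
      exact Subtype.prop (p := fun a => a ∉ S) _
  · intro u
    have hc : castPow k U (rfl : c + e = c + e) = LinearEquiv.refl k _ := by
      unfold castPow
      exact PiTensorProduct.reindex_refl
    rw [hc, LinearEquiv.refl_apply]
    unfold shuffleMul
    rw [LinearMap.sum_apply]
    have hf : Finset.powersetCard c (Finset.univ : Finset (Fin (c + e))) =
      ({S : Finset (Fin (c + e)) | S.card = c} : Finset _) := by
      ext S; simp [Finset.mem_powersetCard]
    rw [hf, ← Finset.sum_attach ({S : Finset (Fin (c + e)) | S.card = c} : Finset _)]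
    refine Finset.sum_congr rfl fun S _ => ?_
    have hS : S.1.card = c := by simpa using S.2
    simp only [hS, dite_true]
    rw [← rx_rx]
    rfl

lemma shufflePiece_formula (M N : Type*) [AddCommGroup M] [Module k M] [AddCommGroup N]
    [Module k N] (d c : ℕ) (hc : c ≤ d) :
    ∃ τ : Finset (Fin d) → (Fin c ⊕ Fin (d - c) ≃ Fin d),
      (∀ S, S.card = c → ∀ x, τ S x ∈ S ↔ x.isLeft) ∧
      ∀ t, shufflePiece (k := k) M N d c hc t =
        ∑ S ∈ Finset.powersetCard c Finset.univ,
          rx k (M × N) (τ S) (gg k M N (Fin c) (Fin (d - c))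
            (TensorProduct.map (dividedPower k M c).subtype
              (dividedPower k N (d - c)).subtype t)) := by
  obtain ⟨τ, h1, h2⟩ := exists_tau (k := k) (M × N) c (d - c) d (by omega)
  refine ⟨τ, h1, fun t => ?_⟩
  unfold shufflePiece
  rw [LinearMap.comp_apply, LinearMap.comp_apply, LinearEquiv.coe_coe, h2]
  refine Finset.sum_congr rfl fun S _ => ?_
  congr 1
  unfold gg
  rw [LinearMap.comp_apply, LinearEquiv.coe_coe]
  congr 1
  rw [← LinearMap.comp_apply (TensorProduct.map _ _), ← TensorProduct.map_comp]
  rfl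

/-- Invariance under both symmetric groups. -/
def Inv2 {M N : Type*} [AddCommGroup M] [Module k M] [AddCommGroup N]
    [Module k N] {α β : Type*} (w : (⨂[k] _ : α, M) ⊗[k] (⨂[k] _ : β, N)) : Prop :=
  ∀ (h₁ : Equiv.Perm α) (h₂ : Equiv.Perm β), TensorProduct.map (rx k M h₁) (rx k N h₂) w = w

lemma inv2_sub {c e : ℕ} (t : ↥(dividedPower k V c) ⊗[k] ↥(dividedPower k W e)) :
    Inv2 (k := k) (M := V) (N := W) (α := Fin c) (β := Fin e)
      (TensorProduct.map (dividedPower k V c).subtype (dividedPower k W e).subtype t) := by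
  intro h₁ h₂
  rw [← LinearMap.comp_apply, ← TensorProduct.map_comp]
  congr 2
  · ext x : 1
    exact x.2 h₁
  · ext x : 1
    exact x.2 h₂

lemma two_tau [Finite α] [Finite β] {w : (⨂[k] _ : α, V) ⊗[k] (⨂[k] _ : β, W)} (hw : Inv2 w)
    (τ τ' : α ⊕ β ≃ ι) (S : Finset ι)
    (hS : ∀ x, τ x ∈ S ↔ x.isLeft) (hS' : ∀ x, τ' x ∈ S ↔ x.isLeft) :
    rx k _ τ (gg k V W α β w) = rx k _ τ' (gg k V W α β w) := by
  obtain ⟨h₁, h₂, h⟩ := exists_sumCongr (τ.trans τ'.symm) (fun x => by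
    have h1 := hS x
    have h2 := hS' ((τ.trans τ'.symm) x)
    simp only [Equiv.trans_apply, Equiv.apply_symm_apply] at h2 ⊢
    rw [Bool.eq_iff_iff]
    exact h2.symm.trans h1)
  have h3 : τ = (Equiv.sumCongr h₁ h₂).trans τ' := by
    rw [← h]; ext; simp
  rw [h3, ← rx_rx, rx_gg, hw]

lemma rx_inv {d : ℕ} {z : ⨂[k]^d V} (hz : z ∈ dividedPower k V d) (a b : Fin d ≃ μ) :
    rx k V a z = rx k V b z := by
  have h := mem_dp.1 hz (b.trans a.symm)
  conv_lhs => rw [← h]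
  rw [rx_rx]
  congr 2
  ext; simp

end
end Helpers

/-- for each `0 ≤ c ≤ d` the shuffle multiplication
`Γ^c M ⊗ Γ^{d-c} N → Γ^d(M ⊕ N)` is injective, and `Γ^d (M ⊕ N)` is the (internal)
direct sum of the images `Γ^c(M) * Γ^{d-c}(N)`. -/
theorem dividedPower_directSum_decomposition
    {k : Type*} [CommRing k] {d : ℕ} (hd : 0 < d)
    (M N : Type*)
    [AddCommGroup M] [Module k M] [Module.Finite k M] [Module.Projective k M]
    [AddCommGroup N] [Module k N] [Module.Finite k N] [Module.Projective k N] :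
    (∀ c : Fin (d + 1),
      Function.Injective (shufflePiece (k := k) M N d (c : ℕ) (Nat.lt_succ_iff.mp c.isLt))) ∧
    iSupIndep (fun c : Fin (d + 1) =>
      LinearMap.range (shufflePiece (k := k) M N d (c : ℕ) (Nat.lt_succ_iff.mp c.isLt))) ∧
    (⨆ c : Fin (d + 1),
      LinearMap.range (shufflePiece (k := k) M N d (c : ℕ) (Nat.lt_succ_iff.mp c.isLt))) =
        dividedPower k (M × N) d := by
  classical
  choose τ hτ hform using fun c : Fin (d + 1) =>
    shufflePiece_formula (k := k) M N d (c : ℕ) (Nat.lt_succ_iff.mp c.isLt)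
  have hS0 : ∀ c : Fin (d + 1), ∃ S : Finset (Fin d), S.card = (c : ℕ) := by
    intro c
    obtain ⟨S, -, hS⟩ := Finset.exists_subset_card_eq
      (s := (Finset.univ : Finset (Fin d))) (n := (c : ℕ)) (by simpa using Nat.lt_succ_iff.mp c.isLt)
    exact ⟨S, hS⟩
  choose S0 hS0 using hS0
  let ρ := fun c : Fin (d + 1) => hh k M N (Fin c) (Fin (d - c)) ∘ₗ rx k (M × N) (τ c (S0 c)).symm
  have hρ : ∀ c x, ρ c x = hh k M N (Fin c) (Fin (d - c)) (rx k (M × N) (τ c (S0 c)).symm x) :=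
    fun c x => rfl
  have hρpi : ∀ c x, ρ c (piS k M N (S0 c) x) = ρ c x := by
    intro c x
    have h1 : x = rx k (M × N) (τ c (S0 c)) (rx k (M × N) (τ c (S0 c)).symm x) := by
      rw [rx_rx, Equiv.symm_trans_self, rx_refl]
    conv_lhs => rw [h1]
    rw [piS_rx (τ c (S0 c)) (S0 c) (hτ c _ (hS0 c)), hρ, rx_rx, Equiv.self_trans_symm, rx_refl,
      hh_gg, hρ]
  have hpi : ∀ (c : Fin (d + 1)) (S : Finset (Fin d)), S.card = (c : ℕ) → ∀ w,
      piS k M N S (rx k (M × N) (τ c S) (gg k M N (Fin c) (Fin (d - c)) w)) =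
        rx k (M × N) (τ c S) (gg k M N (Fin c) (Fin (d - c)) w) := by
    intro c S hS w
    rw [piS_rx (τ c S) S (hτ c _ hS), hh_gg]
  have hterm : ∀ (c c' : Fin (d + 1)) (S : Finset (Fin d)), S.card = (c' : ℕ) → S ≠ S0 c → ∀ w,
      ρ c (rx k (M × N) (τ c' S) (gg k M N (Fin c') (Fin (d - c')) w)) = 0 := by
    intro c c' S hS hne w
    rw [← hρpi, ← hpi c' S hS, piS_ne (Ne.symm hne), map_zero]
  have hself : ∀ c t, ρ c (shufflePiece (k := k) M N d (c : ℕ) (Nat.lt_succ_iff.mp c.isLt) t) =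
      TensorProduct.map (dividedPower k M c).subtype (dividedPower k N (d - c)).subtype t := by
    intro c t
    rw [hform, map_sum, Finset.sum_eq_single (S0 c)]
    · rw [hρ, rx_rx, Equiv.self_trans_symm, rx_refl, hh_gg]
    · intro S hS hne
      exact hterm c c S (Finset.mem_powersetCard.1 hS).2 hne _
    · intro h
      exact absurd (Finset.mem_powersetCard.2 ⟨Finset.subset_univ _, hS0 c⟩) h
  have hother : ∀ c c', c ≠ c' → ∀ t,
      ρ c (shufflePiece (k := k) M N d (c' : ℕ) (Nat.lt_succ_iff.mp c'.isLt) t) = 0 := by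
    intro c c' hcc t
    rw [hform, map_sum]
    refine Finset.sum_eq_zero fun S hS => ?_
    have hS' := (Finset.mem_powersetCard.1 hS).2
    refine hterm c c' S hS' ?_ _
    rintro rfl
    exact hcc (Fin.ext ((hS0 c).symm.trans hS'))
  choose RM hRM using fun c : ℕ => goodProj_exists (k := k) M c
  choose RN hRN using fun c : ℕ => goodProj_exists (k := k) N c
  let rM := fun c : ℕ => (RM c).codRestrict (dividedPower k M c) (hRM c).1
  let rN := fun c : ℕ => (RN c).codRestrict (dividedPower k N c) (hRN c).1
  have hrM : ∀ c, rM c ∘ₗ (dividedPower k M c).subtype = LinearMap.id := by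
    intro c
    apply LinearMap.ext
    intro x
    exact Subtype.ext ((hRM c).fix x x.2)
  have hrN : ∀ c, rN c ∘ₗ (dividedPower k N c).subtype = LinearMap.id := by
    intro c
    apply LinearMap.ext
    intro x
    exact Subtype.ext ((hRN c).fix x x.2)
  have hinj : ∀ c e : ℕ, Function.Injective
      (TensorProduct.map (dividedPower k M c).subtype (dividedPower k N e).subtype) := by
    intro c e
    apply Function.LeftInverse.injective (g := TensorProduct.map (rM c) (rN e))
    intro t
    rw [← LinearMap.comp_apply, ← TensorProduct.map_comp, hrM, hrN, TensorProduct.map_id,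
      LinearMap.id_apply]
  refine ⟨?_, ?_, ?_⟩
  · intro c t t' htt
    apply hinj
    rw [← hself, ← hself, htt]
  · intro c
    rw [Submodule.disjoint_def]
    rintro _ ⟨t, rfl⟩ hx
    have hker : (⨆ (j : Fin (d + 1)) (_ : j ≠ c), LinearMap.range
        (shufflePiece (k := k) M N d (j : ℕ) (Nat.lt_succ_iff.mp j.isLt))) ≤
        LinearMap.ker (ρ c) := by
      refine iSup₂_le fun j hj => ?_
      rintro _ ⟨t, rfl⟩
      exact hother c j hj.symm t
    have h0 := hker hx
    rw [LinearMap.mem_ker, hself] at h0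
    have : t = 0 := hinj _ _ (by rw [h0, map_zero])
    rw [this, map_zero]
  · apply le_antisymm
    · refine iSup_le fun c => ?_
      rintro _ ⟨t, rfl⟩
      rw [mem_dp]
      intro σ
      rw [hform, map_sum]
      refine Finset.sum_equiv (Equiv.finsetCongr σ) ?_ ?_
      · intro S
        simp [Finset.mem_powersetCard]
      · intro S hS
        have hS' := (Finset.mem_powersetCard.1 hS).2
        rw [rx_rx]
        refine two_tau (inv2_sub t) _ _ (Equiv.finsetCongr σ S) ?_ ?_
        · intro x
          rw [← hτ c S hS' x]
          simp
        · exact hτ c _ (by simpa using hS')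
    · intro z hz
      rw [← piS_sum (k := k) z, ← Finset.powerset_univ, Finset.sum_powerset]
      refine Submodule.sum_mem _ fun c hc => ?_
      rw [Finset.mem_range, Finset.card_univ, Fintype.card_fin] at hc
      obtain ⟨c, rfl⟩ : ∃ c' : Fin (d + 1), (c' : ℕ) = c := ⟨⟨c, hc⟩, rfl⟩
      refine Submodule.mem_iSup_of_mem c ?_
      have hw : Inv2 (ρ c z) := by
        intro h₁ h₂
        rw [hρ, ← hh_rx, rx_rx]
        congr 1
        exact rx_inv hz _ _
      have hfix : TensorProduct.map (RM c) (RN (d - c)) (ρ c z) = ρ c z := by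
        have e1 : (RM c).rTensor _ (ρ c z) = ρ c z := (hRM c).fix_rTensor _ fun σ => by
          have := hw σ (Equiv.refl _)
          have h1 : rx k N (Equiv.refl (Fin (d - c))) = LinearMap.id := LinearMap.ext rx_refl
          rw [h1] at this
          exact this
        have e2 : (RN (d - c)).lTensor _ (ρ c z) = ρ c z := (hRN (d - c)).fix_lTensor _ fun σ => by
          have := hw (Equiv.refl _) σ
          have h1 : rx k M (Equiv.refl (Fin c)) = LinearMap.id := LinearMap.ext rx_refl
          rw [h1] at this
          exact this
        rw [← LinearMap.rTensor_comp_lTensor, LinearMap.comp_apply, e2, e1]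
      refine ⟨TensorProduct.map (rM c) (rN (d - c)) (ρ c z), ?_⟩
      have hsub : TensorProduct.map (dividedPower k M c).subtype (dividedPower k N (d - c)).subtype
          (TensorProduct.map (rM c) (rN (d - c)) (ρ c z)) = ρ c z := by
        rw [← LinearMap.comp_apply, ← TensorProduct.map_comp]
        exact hfix
      rw [hform, hsub]
      refine Finset.sum_congr rfl fun S hS => ?_
      have hS' := (Finset.mem_powersetCard.1 hS).2
      have h1 : z = rx k (M × N) (τ c S) (rx k (M × N) (τ c S).symm z) := by
        rw [rx_rx, Equiv.symm_trans_self, rx_refl]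
      conv_rhs => rw [h1]
      rw [piS_rx (τ c S) S (hτ c _ hS'), hρ, rx_inv hz (τ c (S0 c)).symm (τ c S).symm]
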